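/- For every rational prime ℓ, the first group cohomology of GL₂(𝔽_ℓ) with coefficients in 𝔽_ℓ², where GL₂(𝔽_ℓ) acts on 𝔽_ℓ² by the standard (matrix-vector) action, vanishes: H¹(GL₂(𝔽_ℓ), 𝔽_ℓ²) = 0. -/

import Mathlib

noncomputable section

/-- The standard representation of `GL₂(𝔽_ℓ)` on `𝔽_ℓ²` by matrix-vector multiplication. -/
def stdRep (ℓ : ℕ) : Representation (ZMod ℓ) (GL (Fin 2) (ZMod ℓ)) (Fin 2 → ZMod ℓ) where
  toFun g := Matrix.mulVecLin (g : Matrix (Fin 2) (Fin 2) (ZMod ℓ))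
  map_one' := by ext v i; simp
  map_mul' g h := by ext v i; simp [Matrix.mulVecLin_mul]

/-- If `z : G` generates a normal subgroup and `ρ(z) - 1` is bijective on `A`, then
`H¹(G, A) = 0`. -/
theorem H1_eq_zero_of_normal_zpowers.{u} {k G : Type u} [CommRing k] [Group G]
    (A : Rep.{u} k G) (z : G) [hz : (Subgroup.zpowers z).Normal]
    (hb : Function.Bijective fun v : A => A.ρ z v - v)
    (x : groupCohomology.H1 A) : x = 0 := by
  induction x using groupCohomology.H1_induction_on with | h c =>
  rw [groupCohomology.H1π_eq_zero_iff]
  obtain ⟨v, hv⟩ := hb.2 (c z)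
  refine ⟨v, funext fun g => ?_⟩
  have hc := (groupCohomology.mem_cocycles₁_iff (c : G → A)).1 c.2
  let d : G → A := fun g => c g - (A.ρ g v - v)
  have hd (g h : G) : d (g * h) = A.ρ g (d h) + d g := by
    simp only [d, hc, map_mul, Module.End.mul_apply, map_sub]
    abel
  have hd_one : d 1 = 0 := by simpa using hd 1 1
  have hd_z : d z = 0 := sub_eq_zero.2 hv.symm
  have hd_zpowers {w : G} (hw : w ∈ Subgroup.zpowers z) : d w = 0 := by
    rw [Subgroup.zpowers_eq_closure] at hw
    induction hw using Subgroup.closure_induction with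
    | mem w hw => rwa [Set.mem_singleton_iff.1 hw]
    | one => exact hd_one
    | mul a b _ _ ha hb => rw [hd, ha, hb, map_zero, add_zero]
    | inv a _ ha => simpa [hd_one, ha] using (hd a⁻¹ a).symm
  have hd_conj : d g = A.ρ (g * z * g⁻¹) (d g) := by
    have h := hd (g * z * g⁻¹) g
    rwa [inv_mul_cancel_right, hd g z, hd_z, map_zero, zero_add,
      hd_zpowers (hz.conj_mem z (Subgroup.mem_zpowers z) g), add_zero] at h
  have hd_inv : A.ρ g⁻¹ (d g) = 0 := by
    refine hb.1 ?_
    have h := congrArg (A.ρ g⁻¹) hd_conj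
    rw [← Module.End.mul_apply, ← map_mul, mul_assoc, inv_mul_cancel_left, map_mul,
      Module.End.mul_apply] at h
    simp [← h]
  have hd_g : d g = 0 := by simpa using congrArg (A.ρ g) hd_inv
  exact (sub_eq_zero.1 hd_g).symm

/-- The matrix `!![0, 1; 1, 1]`, an element of order three in `GL₂(𝔽₂)`. -/
def orderThree : GL (Fin 2) (ZMod 2) :=
  ⟨!![0, 1; 1, 1], !![1, 1; 1, 0], by decide, by decide⟩

instance normal_zpowers_orderThree : (Subgroup.zpowers orderThree).Normal := by
  have key : ∀ g : Matrix (Fin 2) (Fin 2) (ZMod 2), g.det ≠ 0 →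
      g * !![0, 1; 1, 1] = !![0, 1; 1, 1] * g ∨
        g * !![0, 1; 1, 1] = !![0, 1; 1, 1] ^ 2 * g := by
    decide
  have hconj (g : GL (Fin 2) (ZMod 2)) :
      g * orderThree * g⁻¹ ∈ Subgroup.zpowers orderThree := by
    rcases key g (Matrix.GeneralLinearGroup.det_ne_zero g) with h | h
    · exact ⟨1, eq_mul_inv_iff_mul_eq.2 ((congrArg (· * g) (zpow_one _)).trans (Units.ext h.symm))⟩
    · exact ⟨2, eq_mul_inv_iff_mul_eq.2 (Units.ext h.symm)⟩
  refine ⟨fun n hn g => ?_⟩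
  obtain ⟨m, rfl⟩ := hn
  simpa only [conj_zpow] using zpow_mem (hconj g) m

instance normal_zpowers_neg_one {R : Type*} [CommRing R] :
    (Subgroup.zpowers (-1 : GL (Fin 2) R)).Normal := by
  refine ⟨fun n hn g => ?_⟩
  obtain ⟨m, rfl⟩ := hn
  have hcomm : Commute g (-1) := (Commute.one_right g).neg_right
  exact ⟨m, eq_mul_inv_iff_mul_eq.2 (hcomm.zpow_right m).eq.symm⟩

/-- For every rational prime `ℓ`, the first group cohomology of `GL₂(𝔽_ℓ)` with
coefficients in `𝔽_ℓ²` (with the standard matrix-vector action) vanishes: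
`H¹(GL₂(𝔽_ℓ), 𝔽_ℓ²) = 0`. -/
theorem h1_GL2_std_eq_zero (ℓ : ℕ) (hℓ : ℓ.Prime) :
    ∀ x : groupCohomology.H1 (Rep.of (stdRep ℓ)), x = 0 := by
  rcases eq_or_ne ℓ 2 with rfl | h2
  · have hb : Function.Bijective fun v : Fin 2 → ZMod 2 =>
        Matrix.mulVec !![0, 1; 1, 1] v - v := by
      decide
    exact H1_eq_zero_of_normal_zpowers (Rep.of (stdRep 2)) orderThree hb
  · have := Fact.mk hℓ
    have h2' : (-2 : ZMod ℓ) ≠ 0 := by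
      rw [neg_ne_zero]
      exact Ring.two_ne_zero (by rwa [ZMod.ringChar_zmod_n])
    have hb : Function.Bijective fun v : Fin 2 → ZMod ℓ => stdRep ℓ (-1) v - v := by
      convert MulAction.bijective (β := Fin 2 → ZMod ℓ) (Units.mk0 _ h2') using 2 with v
      ext i
      simp [stdRep, Units.smul_def]
      ring
    exact H1_eq_zero_of_normal_zpowers (Rep.of (stdRep ℓ)) (-1) hb

end
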